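/- Let β be odd and let C = ⟨(b | 0), (ℓ | fh + 2f)⟩ be a Z2Z4-additive cyclic code in standard form, where fhg = x^β − 1 in Z4[x] and b divides x^α − 1 in Z2[x]. Then there exist polynomials b_k, ℓ_k ∈ Z2[x] and f_k, h_k, g_k ∈ Z4[x] with f_k h_k g_k = x^β − 1 and b_k dividing x^α − 1, such that K(C) = ⟨(b_k | 0), (ℓ_k | f_k h_k + 2f_k)⟩, and moreover (1) f divides f_k in Z4[x], and (2) gcd(b, ℓ) divides gcd(b_k, ℓ_k) in Z2[x]. -/

import Mathlib

open Polynomial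

namespace Z2Z4

variable {α β : ℕ}

/-- The ambient space `ℤ₂^α × ℤ₄^β`. -/
abbrev V (α β : ℕ) := (Fin α → ZMod 2) × (Fin β → ZMod 4)

/-- The binary ambient space `ℤ₂^(α+2β)`, written as a product. -/
abbrev B (α β : ℕ) := (Fin α → ZMod 2) × ((Fin β → ZMod 2) × (Fin β → ZMod 2))

/-- The double cyclic shift `π(u | u') = (u_{α-1},u_0,…,u_{α-2} | u'_{β-1},u'_0,…,u'_{β-2})`. -/
def shift (v : V α β) : V α β :=
  (fun i => v.1 ((finRotate α).symm i), fun i => v.2 ((finRotate β).symm i))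

/-- For `z = t + 2h` with `t,h ∈ {0,1}`, this is `h`. -/
def grayHat (z : ZMod 4) : ZMod 2 := ((z.val / 2 : ℕ) : ZMod 2)

/-- For `z = t + 2h` with `t,h ∈ {0,1}`, this is `t`. -/
def grayTilde (z : ZMod 4) : ZMod 2 := ((z.val % 2 : ℕ) : ZMod 2)

/-- The Gray map `φ(u') = (û', ũ' + û')`. -/
def phi (u : Fin β → ZMod 4) : (Fin β → ZMod 2) × (Fin β → ZMod 2) :=
  (fun i => grayHat (u i), fun i => grayTilde (u i) + grayHat (u i))

/-- The extended Gray map `Φ(u | u') = (u, φ(u'))`. -/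
def Phi (v : V α β) : B α β := (v.1, phi v.2)

/-- `2v*w = (0 | 2(v' * w'))`, componentwise product on the quaternary part. -/
def twoStar (v w : V α β) : V α β := (0, fun i => 2 * v.2 i * w.2 i)

/-- The kernel `K(C) = {v ∈ C : 2v*w ∈ C for all w ∈ C}`. -/
def K (C : Set (V α β)) : Set (V α β) :=
  {v ∈ C | ∀ w ∈ C, twoStar v w ∈ C}

/-- `R(C) = {v : Φ(v) ∈ ⟨Φ(C)⟩}`. -/
def R (C : Set (V α β)) : Set (V α β) :=
  {v | Phi v ∈ Submodule.span (ZMod 2) (Phi '' C)}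

/-- The kernel of a quaternary code `D ⊆ ℤ₄^β`. -/
def KQ (D : Set (Fin β → ZMod 4)) : Set (Fin β → ZMod 4) :=
  {v ∈ D | ∀ w ∈ D, (fun i => 2 * v i * w i) ∈ D}

/-- `R(D) = {v' : φ(v') ∈ ⟨φ(D)⟩}` for a quaternary code `D ⊆ ℤ₄^β`. -/
def RQ (D : Set (Fin β → ZMod 4)) : Set (Fin β → ZMod 4) :=
  {v | phi v ∈ Submodule.span (ZMod 2) (phi '' D)}

/-- The kernel of a binary code: `{x : x + D = D}`. -/
def kerSet {M : Type*} [AddCommGroup M] (D : Set M) : Set M :=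
  {x | (fun d => x + d) '' D = D}

/-- The dimension of the kernel of a binary code. -/
noncomputable def dimKer {M : Type*} [AddCommGroup M] [Module (ZMod 2) M] (D : Set M) : ℕ :=
  Module.finrank (ZMod 2) (Submodule.span (ZMod 2) (kerSet D))

/-- The rank of a binary code: the dimension of its linear span. -/
noncomputable def rankOf {M : Type*} [AddCommGroup M] [Module (ZMod 2) M] (D : Set M) : ℕ :=
  Module.finrank (ZMod 2) (Submodule.span (ZMod 2) D)

/-- `Φ(S)` is linear (closed under addition). -/
def grayAddClosed (S : Set (V α β)) : Prop :=
  ∀ x ∈ Phi '' S, ∀ y ∈ Phi '' S, x + y ∈ Phi '' S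

/-- `φ(D)` is linear (closed under addition), for a quaternary code. -/
def grayAddClosedQ (D : Set (Fin β → ZMod 4)) : Prop :=
  ∀ x ∈ phi '' D, ∀ y ∈ phi '' D, x + y ∈ phi '' D

/-- The modulo-2 reduction `ℤ₄ → ℤ₂`. -/
def red2c : ZMod 4 →+* ZMod 2 := ZMod.castHom (show 2 ∣ 4 by norm_num) (ZMod 2)

/-- The modulo-2 reduction of a polynomial over `ℤ₄`. -/
noncomputable def red2 : Polynomial (ZMod 4) →+* Polynomial (ZMod 2) := Polynomial.mapRingHom red2c

/-- Scalar multiplication of `c ∈ ℤ₄` on `ℤ₂^α × ℤ₄^β` (mod-2 reduction on the binary part). -/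
def smul4 (c : ZMod 4) (v : V α β) : V α β := (red2c c • v.1, c • v.2)

/-- The action of a polynomial `p ∈ ℤ₄[x]`: `p ⋆ v = ∑ p_j • π^j(v)`, which is the
module action of `ℤ₄[x]` on `ℤ₂[x]/(x^α-1) × ℤ₄[x]/(x^β-1)` in vector form. -/
noncomputable def polyAct (p : Polynomial (ZMod 4)) (v : V α β) : V α β :=
  ∑ j ∈ Finset.range (p.natDegree + 1), smul4 (p.coeff j) (shift^[j] v)

/-- The vector in `ℤ₂^α` corresponding to `p mod (x^α - 1)`. -/
noncomputable def toVec2 (p : Polynomial (ZMod 2)) : Fin α → ZMod 2 :=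
  fun i => ∑ j ∈ Finset.range (p.natDegree + 1), if j % α = (i : ℕ) then p.coeff j else 0

/-- The vector in `ℤ₄^β` corresponding to `p mod (x^β - 1)`. -/
noncomputable def toVec4 (p : Polynomial (ZMod 4)) : Fin β → ZMod 4 :=
  fun i => ∑ j ∈ Finset.range (p.natDegree + 1), if j % β = (i : ℕ) then p.coeff j else 0

/-- The `ℤ₄[x]`-submodule of `R_{α,β}` generated by `(b | 0)` and `(ℓ | a)`, in vector form. -/
def genCode (α β : ℕ) (b ℓ : Polynomial (ZMod 2)) (a : Polynomial (ZMod 4)) : Set (V α β) :=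
  {x : V α β | ∃ p q : Polynomial (ZMod 4),
    x = polyAct p (toVec2 b, 0) + polyAct q (toVec2 ℓ, toVec4 a)}

/-- The `ℤ₂ℤ₄`-additive cyclic code `⟨(b | 0), (ℓ | fh + 2f)⟩`. -/
def stdCode (α β : ℕ) (b ℓ : Polynomial (ZMod 2)) (f h : Polynomial (ZMod 4)) : Set (V α β) :=
  genCode α β b ℓ (f * h + 2 * f)

end Z2Z4

namespace Z2Z4

section Fold

variable {R : Type*} [CommRing R]

/-- The vector of `p mod (x^n - 1)`, over an arbitrary commutative ring, as an additive map. -/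
noncomputable def foldVec (R : Type*) [CommRing R] (n : ℕ) : R[X] →+ (Fin n → R) :=
  AddMonoidHom.mk' (fun p i => p.sum fun j c => if j % n = (i : ℕ) then c else 0) fun p q => by
    funext i
    refine sum_add_index p q _ (fun j => by simp) fun j a b => ?_
    split_ifs <;> simp

theorem foldVec_apply (n : ℕ) (p : R[X]) (i : Fin n) :
    foldVec R n p i = p.sum fun j c => if j % n = (i : ℕ) then c else 0 := rfl

theorem foldVec_monomial (n j : ℕ) (c : R) (i : Fin n) :
    foldVec R n (monomial j c) i = if j % n = (i : ℕ) then c else 0 := by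
  rw [foldVec_apply, sum_monomial_index _ _ (by simp)]

theorem foldVec_C_mul (n : ℕ) (c : R) (p : R[X]) :
    foldVec R n (C c * p) = c • foldVec R n p := by
  funext i
  induction p using Polynomial.induction_on' with
  | add p q hp hq => simp_all [mul_add]
  | monomial j a => simp [C_mul_monomial, foldVec_monomial]

theorem succ_mod_eq_iff {n : ℕ} (j : ℕ) (i : Fin n) :
    (j + 1) % n = (i : ℕ) ↔ j % n = ((finRotate n).symm i : ℕ) := by
  obtain ⟨m, rfl⟩ := (finRotate n).surjective i
  rw [Equiv.symm_apply_apply]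
  cases n with
  | zero => exact m.elim0
  | succ k =>
    have hm : ((finRotate (k + 1) m : Fin (k + 1)) : ℕ) = ((m : ℕ) + 1) % (k + 1) := by
      rw [finRotate_apply, Fin.val_add, Fin.val_one', Nat.add_mod_mod]
    rw [hm]
    constructor
    · intro h
      have := Nat.ModEq.add_right_cancel' 1 (show j + 1 ≡ m + 1 [MOD (k + 1)] from h)
      rwa [Nat.ModEq, Nat.mod_eq_of_lt m.2] at this
    · intro h
      rw [← h, Nat.mod_add_mod]

theorem foldVec_X_mul (n : ℕ) (p : R[X]) (i : Fin n) :
    foldVec R n (X * p) i = foldVec R n p ((finRotate n).symm i) := by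
  induction p using Polynomial.induction_on' with
  | add p q hp hq => simp_all [mul_add]
  | monomial j a => simp only [X_mul_monomial, foldVec_monomial, succ_mod_eq_iff]

theorem foldVec_mul_X_pow_sub_one (n : ℕ) (p : R[X]) : foldVec R n (p * (X ^ n - 1)) = 0 := by
  funext i
  induction p using Polynomial.induction_on' with
  | add p q hp hq => simp_all [add_mul]
  | monomial j a => simp [mul_sub, monomial_mul_X_pow, foldVec_monomial]

theorem foldVec_eq_coeff {n : ℕ} {p : R[X]} (hp : p.degree < n) (i : Fin n) :
    foldVec R n p i = p.coeff i := by
  rw [foldVec_apply, sum_over_range' p (by simp) n, Finset.sum_eq_single (i : ℕ)]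
  · simp [Nat.mod_eq_of_lt i.2]
  · intro j hj hji
    rw [Nat.mod_eq_of_lt (Finset.mem_range.1 hj), if_neg hji]
  · simp
  · by_cases h : p = 0
    · simp [h, i.pos]
    · exact (natDegree_lt_iff_degree_lt h).2 hp

theorem X_pow_sub_one_dvd_of_foldVec_eq_zero [Nontrivial R] {n : ℕ} (hn : n ≠ 0) {p : R[X]}
    (hp : foldVec R n p = 0) : X ^ n - 1 ∣ p := by
  have hm : (X ^ n - 1 : R[X]).Monic := monic_X_pow_sub_C 1 hn
  have hd : (p %ₘ (X ^ n - 1)).degree < n := by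
    have h := degree_modByMonic_lt p hm
    rwa [← C_1, degree_X_pow_sub_C (Nat.pos_of_ne_zero hn) (1 : R), C_1] at h
  rw [← modByMonic_eq_zero_iff_dvd hm]
  have h0 : foldVec R n (p %ₘ (X ^ n - 1)) = 0 := by
    rw [modByMonic_eq_sub_mul_div, map_sub, hp, mul_comm, foldVec_mul_X_pow_sub_one, sub_zero]
  ext k
  by_cases hk : k < n
  · simpa [foldVec_eq_coeff hd] using congrFun h0 ⟨k, hk⟩
  · rw [coeff_zero, coeff_eq_zero_of_degree_lt (hd.trans_le (by exact_mod_cast not_lt.1 hk))]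

theorem foldVec_surjective (n : ℕ) : Function.Surjective (foldVec R n) := by
  intro v
  refine ⟨∑ i : Fin n, monomial (i : ℕ) (v i), ?_⟩
  funext i
  rw [map_sum, Finset.sum_apply, Finset.sum_eq_single i]
  · simp [foldVec_monomial, Nat.mod_eq_of_lt i.2]
  · intro j _ hj
    rw [foldVec_monomial, Nat.mod_eq_of_lt j.2, if_neg (by simpa [Fin.ext_iff] using hj)]
  · simp

end Fold

section Quaternary

theorem red2_surjective : Function.Surjective red2 :=
  map_surjective _ (ZMod.castHom_surjective _)

theorem red2_eq_zero_iff {p : (ZMod 4)[X]} : red2 p = 0 ↔ ∃ q, p = 2 * q := by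
  constructor
  · intro h
    have hc : ∀ c : ZMod 4, red2c c = 0 → (2 : ZMod 4) ∣ c := by decide
    have h2 : C (2 : ZMod 4) ∣ p := by
      rw [C_dvd_iff_dvd_coeff]
      intro i
      apply hc
      simpa [red2] using congrArg (fun r => coeff r i) h
    exact h2
  · rintro ⟨q, rfl⟩
    have : (red2 2 : (ZMod 2)[X]) = 0 := by
      rw [map_ofNat]; exact CharTwo.two_eq_zero
    rw [map_mul, this, zero_mul]

theorem four_eq_zero : (4 : (ZMod 4)[X]) = 0 := by
  have : C (4 : ZMod 4) = 0 := by rw [show (4 : ZMod 4) = 0 from rfl, C_0]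
  exact this

theorem red2_eq_iff {p q : (ZMod 4)[X]} : red2 p = red2 q ↔ ∃ r, p = q + 2 * r := by
  rw [← sub_eq_zero, ← map_sub, red2_eq_zero_iff]
  simp only [sub_eq_iff_eq_add']

theorem red2_eq_zero_of_two_mul {p : (ZMod 4)[X]} (h : 2 * p = 0) : red2 p = 0 := by
  have hc : ∀ c : ZMod 4, 2 * c = 0 → red2c c = 0 := by decide
  ext i
  have : 2 * p.coeff i = 0 := by
    rw [← coeff_ofNat_mul, h, coeff_zero]
  simpa [red2] using hc _ this

theorem isCoprime_of_red2 {p q : (ZMod 4)[X]} (h : IsCoprime (red2 p) (red2 q)) :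
    IsCoprime p q := by
  obtain ⟨u, v, huv⟩ := h
  obtain ⟨u, rfl⟩ := red2_surjective u
  obtain ⟨v, rfl⟩ := red2_surjective v
  rw [← map_mul, ← map_mul, ← map_add, ← map_one red2, red2_eq_iff] at huv
  obtain ⟨w, hw⟩ := huv
  refine ⟨(1 + 2 * w) * u, (1 + 2 * w) * v, ?_⟩
  linear_combination (1 + 2 * w) * hw + (w + w ^ 2) * four_eq_zero

/-- Hensel's lemma for a coprime factorization modulo two. -/
theorem exists_lift_factorization {P : (ZMod 4)[X]} {a b : (ZMod 2)[X]} (hab : red2 P = a * b)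
    (hco : IsCoprime a b) : ∃ p q, red2 p = a ∧ red2 q = b ∧ p * q = P := by
  obtain ⟨a, rfl⟩ := red2_surjective a
  obtain ⟨b, rfl⟩ := red2_surjective b
  obtain ⟨u, v, huv⟩ := isCoprime_of_red2 hco
  rw [← map_mul, red2_eq_iff] at hab
  obtain ⟨w, hw⟩ := hab
  refine ⟨a + 2 * (w * v), b + 2 * (w * u), red2_eq_iff.2 ⟨_, rfl⟩, red2_eq_iff.2 ⟨_, rfl⟩, ?_⟩
  linear_combination 2 * w * huv - hw + w * v * w * u * four_eq_zero

variable {β : ℕ}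

theorem red2_X_pow_sub_one : red2 (X ^ β - 1) = X ^ β - 1 := by simp [red2]

theorem separable_X_pow_sub_one (hβ : Odd β) : (X ^ β - 1 : (ZMod 2)[X]).Separable := by
  have h : ((β : ℕ) : ZMod 2) ≠ 0 := by
    rw [ZMod.natCast_eq_one_iff_odd.2 hβ]; exact one_ne_zero
  simpa using separable_X_pow_sub_C (1 : ZMod 2) h one_ne_zero

theorem isCoprime_factors (hβ : Odd β) {f h g : (ZMod 4)[X]} (hfhg : f * h * g = X ^ β - 1) :
    IsCoprime (red2 f) (red2 h) ∧ IsCoprime (red2 f) (red2 g) ∧ IsCoprime (red2 h) (red2 g) := by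
  have hs := separable_X_pow_sub_one hβ
  rw [← red2_X_pow_sub_one, ← hfhg, map_mul, map_mul] at hs
  have h1 := hs.isCoprime
  exact ⟨hs.of_mul_left.isCoprime, h1.of_mul_left_left, h1.of_mul_left_right⟩

theorem exists_dvd_red2_iff (I : Ideal (ZMod 4)[X]) :
    ∃ a : (ZMod 2)[X], ∀ p, a ∣ red2 p ↔ ∃ r, p + 2 * r ∈ I := by
  refine ⟨Submodule.IsPrincipal.generator (I.map red2), fun p => ?_⟩
  rw [← Submodule.IsPrincipal.mem_iff_generator_dvd,
    Ideal.mem_map_iff_of_surjective red2 red2_surjective]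
  constructor
  · rintro ⟨q, hq, hqp⟩
    obtain ⟨r, rfl⟩ := red2_eq_iff.1 hqp
    exact ⟨r, hq⟩
  · rintro ⟨r, hr⟩
    exact ⟨_, hr, red2_eq_iff.2 ⟨r, rfl⟩⟩

/-- For odd `β`, every ideal of `ℤ₄[x]` containing `x^β - 1` is generated by `x^β - 1` and
some `fh + 2f` with `f` and `h` complementary factors of a divisor of `x^β - 1`. -/
theorem exists_generator_of_mem (hβ : Odd β) (I : Ideal (ZMod 4)[X])
    (hI : X ^ β - 1 ∈ I) : ∃ f h g : (ZMod 4)[X], f * h * g = X ^ β - 1 ∧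
      I = Ideal.span {f * h + 2 * f, X ^ β - 1} := by
  obtain ⟨a, ha⟩ := exists_dvd_red2_iff I
  obtain ⟨t, ht⟩ := exists_dvd_red2_iff (Submodule.comap (LinearMap.mulLeft _ 2) I)
  replace ht : ∀ p, t ∣ red2 p ↔ 2 * p ∈ I := fun p => by
    have h : ∀ r : (ZMod 4)[X], 2 * (p + 2 * r) = 2 * p := fun r => by
      linear_combination r * four_eq_zero
    simp [ht, h]
  have hta : t ∣ a := by
    obtain ⟨a, rfl⟩ := red2_surjective a
    obtain ⟨r, hr⟩ := (ha a).1 dvd_rfl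
    rw [ht]
    have : 2 * a = 2 * (a + 2 * r) := by linear_combination - r * four_eq_zero
    rw [this]
    exact I.mul_mem_left _ hr
  obtain ⟨k, rfl⟩ := hta
  obtain ⟨s, hs⟩ := (ha (X ^ β - 1)).2 ⟨0, by simpa using hI⟩
  have hsep := separable_X_pow_sub_one hβ
  rw [← red2_X_pow_sub_one, hs] at hsep
  obtain ⟨A, g, hA, hg, hAg⟩ := exists_lift_factorization hs hsep.isCoprime
  obtain ⟨f, h, hf, hh, rfl⟩ := exists_lift_factorization hA hsep.of_mul_left.isCoprime
  obtain ⟨-, hfg, hhg⟩ := isCoprime_factors hβ hAg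
  subst hf hh hg
  have h2f : 2 * f ∈ I := (ht f).1 dvd_rfl
  have hfh : f * h ∈ I := by
    obtain ⟨u, hu⟩ := (ha (f * h)).1 (by rw [map_mul])
    have hgu : 2 * (g * u) ∈ I := by
      have : 2 * (g * u) = g * (f * h + 2 * u) - (X ^ β - 1) := by linear_combination - hAg
      rw [this]
      exact I.sub_mem (I.mul_mem_left _ hu) hI
    rw [← ht, map_mul] at hgu
    have := (ht u).1 (hfg.dvd_of_dvd_mul_left hgu)
    simpa using I.sub_mem hu this
  refine ⟨f, h, g, hAg, le_antisymm (fun r hr => ?_) ?_⟩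
  · obtain ⟨p, hp⟩ := (ha r).2 ⟨0, by simpa using hr⟩
    obtain ⟨p, rfl⟩ := red2_surjective p
    rw [← map_mul, ← map_mul, red2_eq_iff] at hp
    obtain ⟨w, rfl⟩ := hp
    have hw : 2 * w ∈ I := by
      simpa using I.sub_mem hr (I.mul_mem_right p hfh)
    obtain ⟨q, hq⟩ := (ht w).2 hw
    obtain ⟨q, rfl⟩ := red2_surjective q
    rw [← map_mul, red2_eq_iff] at hq
    obtain ⟨z, rfl⟩ := hq
    obtain ⟨u, v, huv⟩ := isCoprime_of_red2 hhg
    rw [Ideal.mem_span_pair]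
    refine ⟨p + (q - p) * (2 * u + v * g), - (q - p) * v, ?_⟩
    linear_combination (q - p) * v * hAg + 2 * f * (q - p) * huv +
      (u * f * (q - p) - z) * four_eq_zero
  · rw [Ideal.span_le, Set.insert_subset_iff, Set.singleton_subset_iff]
    exact ⟨I.add_mem hfh h2f, hI⟩

/-- Divisibility of `f_k(h_k + 2)` by a divisor of `x^β - 1` passes to `f_k`. -/
theorem dvd_of_dvd_mul_add (hβ : Odd β) {f fk hk gk : (ZMod 4)[X]}
    (hk1 : fk * hk * gk = X ^ β - 1) (hf : f ∣ X ^ β - 1) (hd : f ∣ fk * hk + 2 * fk) :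
    f ∣ fk := by
  obtain ⟨c1, -, c3⟩ := isCoprime_factors hβ hk1
  obtain ⟨u, v, huv⟩ := isCoprime_of_red2 c3
  have hfh : f ∣ 2 * fk * hk := by
    have : 2 * fk * hk = 2 * (fk * hk + 2 * fk) := by
      linear_combination - fk * four_eq_zero
    rw [this]; exact hd.mul_left _
  have hfg : f ∣ 2 * fk * gk := by
    have : 2 * fk * gk = gk * (fk * hk + 2 * fk) - (X ^ β - 1) := by
      linear_combination - hk1
    rw [this]; exact dvd_sub (hd.mul_left _) hf
  have h2 : f ∣ 2 * fk := by
    have : 2 * fk = u * (2 * fk * hk) + v * (2 * fk * gk) := by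
      linear_combination - 2 * fk * huv
    rw [this]; exact dvd_add (hfh.mul_left _) (hfg.mul_left _)
  have h3 : f ∣ fk * hk := (dvd_add_left h2).1 hd
  have hf0 : red2 f ≠ 0 := by
    intro h0
    have := map_dvd red2 hf
    rw [h0, zero_dvd_iff, red2_X_pow_sub_one] at this
    exact (separable_X_pow_sub_one hβ).ne_zero this
  have h4 : red2 f ∣ red2 fk := by
    obtain ⟨w, hw⟩ := h2
    have hw0 : red2 w = 0 := by
      have : red2 (f * w) = 0 := hw ▸ red2_eq_zero_iff.2 ⟨fk, rfl⟩
      rw [map_mul] at this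
      exact (mul_eq_zero.1 this).resolve_left hf0
    obtain ⟨z, rfl⟩ := red2_eq_zero_iff.1 hw0
    have := red2_eq_zero_of_two_mul (p := fk - f * z) (by linear_combination hw)
    rw [map_sub, sub_eq_zero, map_mul] at this
    exact ⟨_, this⟩
  exact (isCoprime_of_red2 (c1.of_isCoprime_of_dvd_left h4)).dvd_of_dvd_mul_right h3

end Quaternary


section Ambient

variable {α β : ℕ}

theorem toVec2_eq (p : (ZMod 2)[X]) : (toVec2 p : Fin α → ZMod 2) = foldVec (ZMod 2) α p := by
  funext i
  rw [foldVec_apply, sum_over_range _ (by simp), toVec2]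

theorem toVec4_eq (p : (ZMod 4)[X]) : (toVec4 p : Fin β → ZMod 4) = foldVec (ZMod 4) β p := by
  funext i
  rw [foldVec_apply, sum_over_range _ (by simp), toVec4]

/-- The quotient map `ℤ₂[x] × ℤ₄[x] → R_{α,β}` in vector form. -/
noncomputable def fold (α β : ℕ) : (ZMod 2)[X] × (ZMod 4)[X] →+ V α β :=
  (foldVec (ZMod 2) α).prodMap (foldVec (ZMod 4) β)

theorem fold_apply (u : (ZMod 2)[X]) (a : (ZMod 4)[X]) :
    fold α β (u, a) = (toVec2 u, toVec4 a) := by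
  rw [toVec2_eq, toVec4_eq]; rfl

theorem fold_surjective : Function.Surjective (fold α β) :=
  (foldVec_surjective α).prodMap (foldVec_surjective β)

theorem fold_mul_X_pow_sub_one (u : (ZMod 2)[X]) (a : (ZMod 4)[X]) :
    fold α β (u * (X ^ α - 1), a * (X ^ β - 1)) = 0 :=
  Prod.ext (foldVec_mul_X_pow_sub_one α u) (foldVec_mul_X_pow_sub_one β a)

theorem shift_fold (u : (ZMod 2)[X]) (a : (ZMod 4)[X]) :
    shift (fold α β (u, a)) = fold α β (X * u, X * a) :=
  Prod.ext (funext fun i => (foldVec_X_mul α u i).symm)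
    (funext fun i => (foldVec_X_mul β a i).symm)

theorem shift_iterate_fold (j : ℕ) (u : (ZMod 2)[X]) (a : (ZMod 4)[X]) :
    shift^[j] (fold α β (u, a)) = fold α β (X ^ j * u, X ^ j * a) := by
  induction j with
  | zero => simp
  | succ j ih => simp only [Function.iterate_succ_apply', ih, shift_fold, pow_succ', mul_assoc]

theorem smul4_fold (c : ZMod 4) (u : (ZMod 2)[X]) (a : (ZMod 4)[X]) :
    smul4 c (fold α β (u, a)) = fold α β (C (red2c c) * u, C c * a) :=
  Prod.ext (foldVec_C_mul α _ u).symm (foldVec_C_mul β c a).symm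

theorem polyAct_fold (p : (ZMod 4)[X]) (u : (ZMod 2)[X]) (a : (ZMod 4)[X]) :
    polyAct p (fold α β (u, a)) = fold α β (red2 p * u, p * a) := by
  simp only [polyAct, shift_iterate_fold, smul4_fold, ← map_sum]
  congr 1
  refine Prod.ext ?_ ?_
  · conv_rhs => rw [p.as_sum_range_C_mul_X_pow]
    simp [red2, Prod.fst_sum, Finset.sum_mul, mul_assoc]
  · conv_rhs => rw [p.as_sum_range_C_mul_X_pow]
    simp [Prod.snd_sum, Finset.sum_mul, mul_assoc]

theorem mem_genCode_iff {b ℓ : (ZMod 2)[X]} {a : (ZMod 4)[X]} {x : V α β} :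
    x ∈ genCode α β b ℓ a ↔
      ∃ p q : (ZMod 4)[X], x = fold α β (red2 p * b + red2 q * ℓ, q * a) := by
  have h0 : ((toVec2 b, 0) : V α β) = fold α β (b, 0) := by
    rw [fold_apply, toVec4_eq, map_zero]
  refine exists_congr fun p => exists_congr fun q => ?_
  rw [h0, ← fold_apply, polyAct_fold, polyAct_fold, ← map_add, Prod.mk_add_mk, mul_zero, zero_add]

theorem smul4_eq_nsmul (c : ZMod 4) (v : V α β) : smul4 c v = c.val • v := by
  have h2 : ∀ (c : ZMod 4) (x : ZMod 2), red2c c * x = (c.val : ZMod 2) * x := by decide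
  have h4 : ∀ (c x : ZMod 4), c * x = (c.val : ZMod 4) * x := by decide
  refine Prod.ext (funext fun i => ?_) (funext fun i => ?_)
  · exact (h2 c (v.1 i)).trans (nsmul_eq_mul _ _).symm
  · exact (h4 c (v.2 i)).trans (nsmul_eq_mul _ _).symm

theorem polyAct_mem {M : AddSubgroup (V α β)} (hM : ∀ v ∈ M, shift v ∈ M) (p : (ZMod 4)[X])
    {v : V α β} (hv : v ∈ M) : polyAct p v ∈ M := by
  have hj : ∀ j, shift^[j] v ∈ M := fun j => by
    induction j with
    | zero => exact hv
    | succ j ih => rw [Function.iterate_succ_apply']; exact hM _ ih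
  exact M.sum_mem fun j _ => smul4_eq_nsmul (p.coeff j) _ ▸ M.nsmul_mem (hj j) _

theorem shift_injective : Function.Injective (shift : V α β → V α β) := by
  intro v w h
  have h1 := congrArg Prod.fst h
  have h2 := congrArg Prod.snd h
  refine Prod.ext (funext fun i => ?_) (funext fun i => ?_)
  · simpa only [shift, Equiv.symm_apply_apply] using congrFun h1 (finRotate α i)
  · simpa only [shift, Equiv.symm_apply_apply] using congrFun h2 (finRotate β i)

theorem exists_shift_eq {M : AddSubgroup (V α β)} (hM : ∀ v ∈ M, shift v ∈ M) {w : V α β}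
    (hw : w ∈ M) : ∃ v ∈ M, shift v = w := by
  have hinj : Function.Injective (fun v : M => (⟨shift v, hM v v.2⟩ : M)) := fun v w h =>
    Subtype.ext (shift_injective (congrArg Subtype.val h))
  obtain ⟨v, hv⟩ := Finite.surjective_of_injective hinj ⟨w, hw⟩
  exact ⟨v, v.2, congrArg Subtype.val hv⟩

theorem twoStar_add_left (u v w : V α β) :
    twoStar (u + v) w = twoStar u w + twoStar v w :=
  Prod.ext (by simp [twoStar]) (funext fun i => by simp [twoStar]; ring)

theorem twoStar_shift (v w : V α β) : twoStar (shift v) (shift w) = shift (twoStar v w) := rfl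

/-- The additive homomorphism `v ↦ 2v*w`. -/
def twoStarHom (w : V α β) : V α β →+ V α β :=
  AddMonoidHom.mk' (fun v => twoStar v w) fun u v => twoStar_add_left u v w

/-- The kernel `K(M)` of an additive code `M` as an additive subgroup. -/
def kernelSubgroup (M : AddSubgroup (V α β)) : AddSubgroup (V α β) :=
  M ⊓ ⨅ w ∈ M, M.comap (twoStarHom w)

theorem mem_kernelSubgroup {M : AddSubgroup (V α β)} {v : V α β} :
    v ∈ kernelSubgroup M ↔ v ∈ K (M : Set (V α β)) := by
  simp [kernelSubgroup, K, twoStarHom, AddSubgroup.mem_iInf]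

theorem shift_mem_kernelSubgroup {M : AddSubgroup (V α β)} (hM : ∀ v ∈ M, shift v ∈ M)
    (v : V α β) (hv : v ∈ kernelSubgroup M) : shift v ∈ kernelSubgroup M := by
  rw [mem_kernelSubgroup] at hv ⊢
  refine ⟨hM v hv.1, fun w hw => ?_⟩
  obtain ⟨w, hwM, rfl⟩ := exists_shift_eq hM hw
  rw [twoStar_shift]
  exact hM _ (hv.2 w hwM)

/-- The code `⟨(b | 0), (ℓ | a)⟩` as an additive subgroup. -/
def genSubgroup (α β : ℕ) (b ℓ : (ZMod 2)[X]) (a : (ZMod 4)[X]) : AddSubgroup (V α β) where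
  carrier := genCode α β b ℓ a
  zero_mem' := mem_genCode_iff.2 ⟨0, 0, by simp only [map_zero, zero_mul, add_zero]; exact (map_zero (fold α β)).symm⟩
  add_mem' hx hy := by
    obtain ⟨p, q, rfl⟩ := mem_genCode_iff.1 hx
    obtain ⟨p', q', rfl⟩ := mem_genCode_iff.1 hy
    refine mem_genCode_iff.2 ⟨p + p', q + q', ?_⟩
    rw [← map_add, Prod.mk_add_mk, map_add, map_add]
    congr 2 <;> ring
  neg_mem' hx := by
    obtain ⟨p, q, rfl⟩ := mem_genCode_iff.1 hx
    refine mem_genCode_iff.2 ⟨-p, -q, ?_⟩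
    rw [← map_neg, Prod.neg_mk, map_neg, map_neg]
    congr 2 <;> ring

theorem shift_mem_genSubgroup (b ℓ : (ZMod 2)[X]) (a : (ZMod 4)[X]) (v : V α β)
    (hv : v ∈ genSubgroup α β b ℓ a) : shift v ∈ genSubgroup α β b ℓ a := by
  obtain ⟨p, q, rfl⟩ := mem_genCode_iff.1 hv
  refine mem_genCode_iff.2 ⟨X * p, X * q, ?_⟩
  rw [shift_fold]
  have hX : red2 X = X := by simp [red2]
  rw [map_mul, map_mul, hX]
  congr 2 <;> ring

/-- For odd `β`, every additive cyclic code is of the form `⟨(b | 0), (ℓ | fh + 2f)⟩`. -/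
theorem exists_eq_stdCode (hβ : Odd β) (M : AddSubgroup (V α β))
    (hM : ∀ v ∈ M, shift v ∈ M) :
    ∃ (b ℓ : (ZMod 2)[X]) (f h g : (ZMod 4)[X]),
      f * h * g = X ^ β - 1 ∧ b ∣ X ^ α - 1 ∧ (M : Set (V α β)) = stdCode α β b ℓ f h := by
  have hact : ∀ (p : (ZMod 4)[X]) {u a}, fold α β (u, a) ∈ M →
      fold α β (red2 p * u, p * a) ∈ M := fun p u a hu => by
    rw [← polyAct_fold]; exact polyAct_mem hM p hu
  let J : Ideal (ZMod 2)[X] :=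
    { carrier := {u | fold α β (u, 0) ∈ M}
      zero_mem' := by simpa using (map_zero (fold α β)).symm ▸ M.zero_mem
      add_mem' := fun {u v} hu hv => by
        simpa [← map_add] using M.add_mem hu hv
      smul_mem' := fun p u hu => by
        obtain ⟨p, rfl⟩ := red2_surjective p
        simpa using hact p hu }
  let I : Ideal (ZMod 4)[X] :=
    { carrier := {a | ∃ u, fold α β (u, a) ∈ M}
      zero_mem' := ⟨0, by simpa using (map_zero (fold α β)).symm ▸ M.zero_mem⟩
      add_mem' := by
        rintro a a' ⟨u, hu⟩ ⟨u', hu'⟩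
        exact ⟨u + u', by simpa [← map_add] using M.add_mem hu hu'⟩
      smul_mem' := by
        rintro p a ⟨u, hu⟩
        exact ⟨red2 p * u, hact p hu⟩ }
  have hXJ : X ^ α - 1 ∈ J := by
    have := fold_mul_X_pow_sub_one (α := α) (β := β) 1 0
    rw [one_mul, zero_mul] at this
    change fold α β (X ^ α - 1, 0) ∈ M
    exact this ▸ M.zero_mem
  have hXI (q : (ZMod 4)[X]) : fold α β (0, q * (X ^ β - 1)) = 0 := by
    simpa using fold_mul_X_pow_sub_one (α := α) (β := β) 0 q
  obtain ⟨f, h, g, hfhg, hI⟩ := exists_generator_of_mem hβ I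
    ⟨0, by rw [← one_mul (X ^ β - 1), hXI]; exact M.zero_mem⟩
  have hfh : f * h + 2 * f ∈ I := hI ▸ Ideal.subset_span (by simp)
  obtain ⟨ℓ, hℓ⟩ := hfh
  have hb := fun u => Submodule.IsPrincipal.mem_iff_generator_dvd J (x := u)
  set b := Submodule.IsPrincipal.generator J
  refine ⟨b, ℓ, f, h, g, hfhg, (hb _).1 hXJ, Set.ext fun x => ?_⟩
  rw [stdCode, mem_genCode_iff]
  constructor
  · intro hx
    obtain ⟨⟨u, a⟩, rfl⟩ := fold_surjective x
    have ha : a ∈ I := ⟨u, hx⟩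
    rw [hI, Ideal.mem_span_pair] at ha
    obtain ⟨q, r, rfl⟩ := ha
    have hsplit : fold α β (u, q * (f * h + 2 * f) + r * (X ^ β - 1)) =
        fold α β (u, q * (f * h + 2 * f)) := by
      rw [← add_zero (fold α β (u, q * (f * h + 2 * f))), ← hXI r, ← map_add,
        Prod.mk_add_mk, add_zero]
    rw [hsplit] at hx ⊢
    have hu : u - red2 q * ℓ ∈ J := by
      change fold α β (u - red2 q * ℓ, 0) ∈ M
      simpa [← map_sub] using M.sub_mem hx (hact q hℓ)
    obtain ⟨p, hp⟩ := (hb _).1 hu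
    obtain ⟨p, rfl⟩ := red2_surjective p
    exact ⟨p, q, by rw [mul_comm _ b, ← hp, sub_add_cancel]⟩
  · rintro ⟨p, q, rfl⟩
    have hbJ : b ∈ J := (hb b).2 dvd_rfl
    simpa [← map_add] using M.add_mem (hact p hbJ) (hact q hℓ)

theorem genCode_eq_of_zero (b ℓ b' ℓ' : (ZMod 2)[X]) (a : (ZMod 4)[X]) :
    genCode 0 β b ℓ a = genCode 0 β b' ℓ' a := by
  have h : ∀ u v : (ZMod 2)[X], (toVec2 u : Fin 0 → ZMod 2) = toVec2 v := fun u v =>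
    Subsingleton.elim _ _
  simp only [genCode, h b b', h ℓ ℓ']

theorem left_generator_mem (b ℓ : (ZMod 2)[X]) (a : (ZMod 4)[X]) :
    fold α β (b, 0) ∈ genCode α β b ℓ a := mem_genCode_iff.2 ⟨1, 0, by simp⟩

theorem right_generator_mem (b ℓ : (ZMod 2)[X]) (a : (ZMod 4)[X]) :
    fold α β (ℓ, a) ∈ genCode α β b ℓ a := mem_genCode_iff.2 ⟨0, 1, by simp⟩

theorem dvd_left_of_mem (hα : α ≠ 0) {b ℓ d u : (ZMod 2)[X]} {a c : (ZMod 4)[X]}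
    (hd : d ∣ X ^ α - 1) (hb : d ∣ b) (hℓ : d ∣ ℓ)
    (hu : fold α β (u, c) ∈ genCode α β b ℓ a) : d ∣ u := by
  obtain ⟨p, q, h⟩ := mem_genCode_iff.1 hu
  rw [← sub_eq_zero, ← map_sub] at h
  have := X_pow_sub_one_dvd_of_foldVec_eq_zero hα (congrArg Prod.fst h)
  exact (dvd_sub_left ((hb.mul_left _).add (hℓ.mul_left _))).1 (hd.trans this)

theorem dvd_right_of_mem (hβ : β ≠ 0) {b ℓ u : (ZMod 2)[X]} {a c d : (ZMod 4)[X]}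
    (hd : d ∣ X ^ β - 1) (ha : d ∣ a)
    (hu : fold α β (u, c) ∈ genCode α β b ℓ a) : d ∣ c := by
  obtain ⟨p, q, h⟩ := mem_genCode_iff.1 hu
  rw [← sub_eq_zero, ← map_sub] at h
  have : Nontrivial (ZMod 4) := ⟨0, 1, by decide⟩
  have := X_pow_sub_one_dvd_of_foldVec_eq_zero hβ (congrArg Prod.snd h)
  exact (dvd_sub_left (ha.mul_left _)).1 (hd.trans this)

end Ambient

/-- For a `ℤ₂ℤ₄`-additive cyclic code `C = ⟨(b | 0), (ℓ | fh + 2f)⟩` in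
standard form, `K(C) = ⟨(b_k | 0), (ℓ_k | f_k h_k + 2 f_k)⟩` for polynomials with
`f_k h_k g_k = x^β - 1`, `b_k ∣ x^α - 1`, `f ∣ f_k` and `gcd(b, ℓ) ∣ gcd(b_k, ℓ_k)`. -/
theorem kernel_generators_exist (α β : ℕ) (hβ : Odd β) (b ℓ : Polynomial (ZMod 2))
    (f h g : Polynomial (ZMod 4))
    (hfhg : f * h * g = X ^ β - 1) (hb : b ∣ X ^ α - 1) (hℓ : ℓ.degree < b.degree) :
    ∃ (bk ℓk : Polynomial (ZMod 2)) (fk hk gk : Polynomial (ZMod 4)),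
      fk * hk * gk = X ^ β - 1 ∧ bk ∣ X ^ α - 1 ∧
      K (stdCode α β b ℓ f h) = stdCode α β bk ℓk fk hk ∧
      f ∣ fk ∧ EuclideanDomain.gcd b ℓ ∣ EuclideanDomain.gcd bk ℓk := by
  set A := f * h + 2 * f
  have hM := shift_mem_genSubgroup (α := α) (β := β) b ℓ A
  obtain ⟨bk, ℓk, fk, hk, gk, hk1, hbk, hK⟩ :=
    exists_eq_stdCode hβ _ (shift_mem_kernelSubgroup hM)
  replace hK : K (stdCode α β b ℓ f h) = stdCode α β bk ℓk fk hk :=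
    (Set.ext fun _ => mem_kernelSubgroup.symm).trans hK
  have hsub : stdCode α β bk ℓk fk hk ⊆ genCode α β b ℓ A := hK ▸ fun _ hx => hx.1
  have hfX : f ∣ X ^ β - 1 := ⟨h * g, by rw [← hfhg, mul_assoc]⟩
  have hfA : f ∣ A := (dvd_mul_right f h).add (dvd_mul_left f 2)
  have hfk : f ∣ fk := dvd_of_dvd_mul_add hβ hk1 hfX
    (dvd_right_of_mem hβ.pos.ne' hfX hfA (hsub (right_generator_mem _ _ _)))
  obtain rfl | hα := eq_or_ne α 0
  · exact ⟨0, 0, fk, hk, gk, hk1, by simp, hK.trans (genCode_eq_of_zero _ _ _ _ _), hfk, by simp⟩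
  · have hdb := EuclideanDomain.gcd_dvd_left b ℓ
    have hdℓ := EuclideanDomain.gcd_dvd_right b ℓ
    exact ⟨bk, ℓk, fk, hk, gk, hk1, hbk, hK, hfk, EuclideanDomain.dvd_gcd
      (dvd_left_of_mem hα (hdb.trans hb) hdb hdℓ (hsub (left_generator_mem _ _ _)))
      (dvd_left_of_mem hα (hdb.trans hb) hdb hdℓ (hsub (right_generator_mem _ _ _)))⟩

end Z2Z4
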